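/- arXiv:2605.09254 — 5 statements merged into one kernel-verified Lean document; each statement's English description precedes it below -/
import Mathlib

section
/- Let K be an abstract simplicial complex on a finite vertex set V and let σ ∈ K be a nonempty face. Then the set of minimal non-faces of the star deletion sd_σ K is exactly {σ} ∪ {J : J is a minimal non-face of K and σ ⊄ J}. In particular, the only new minimal non-face created by the star deletion at σ is σ itself. -/
/-- A collection of finite subsets of `α` is an abstract simplicial complex if it
contains the empty set and is closed under taking subsets. -/
def IsSimplicialComplex {α : Type*} (K : Set (Finset α)) : Prop :=
  ∅ ∈ K ∧ ∀ s ∈ K, ∀ t ⊆ s, t ∈ K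

/-- `σ` is a minimal non-face of `K`: not a face, but every proper subset is a face. -/
def IsMinNonFace {α : Type*} (K : Set (Finset α)) (σ : Finset α) : Prop :=
  σ ∉ K ∧ ∀ t ⊂ σ, t ∈ K

/-- The star deletion of `K` at `I`: faces of `K` not containing `I`. -/
def starDel {α : Type*} (I : Finset α) (K : Set (Finset α)) : Set (Finset α) :=
  {τ ∈ K | ¬ I ⊆ τ}

/-- **Minimal non-faces of a star deletion.** For a nonempty face `σ ∈ K`, the
minimal non-faces of `sd_σ K` are exactly `σ` together with those minimal non-faces
of `K` not containing `σ`. -/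
theorem minNonFaces_starDel {α : Type*} [DecidableEq α]
    (K : Set (Finset α)) (hK : IsSimplicialComplex K)
    (σ : Finset α) (hσK : σ ∈ K) (hσne : σ.Nonempty) :
    {ρ : Finset α | IsMinNonFace (starDel σ K) ρ} =
      {σ} ∪ {ρ : Finset α | IsMinNonFace K ρ ∧ ¬ σ ⊆ ρ} := by
  ext ρ
  simp only [Set.mem_ofPred_eq, Set.mem_union, Set.mem_singleton_iff]
  constructor
  · rintro ⟨hρ, hmin⟩
    by_cases hσρ : σ ⊆ ρ
    · left
      by_contra hne
      exact (hmin σ (hσρ.ssubset_of_ne (Ne.symm hne))).2 subset_rfl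
    · exact Or.inr ⟨⟨fun h => hρ ⟨h, hσρ⟩, fun t ht => (hmin t ht).1⟩, hσρ⟩
  · rintro (rfl | ⟨⟨hρ, hmin⟩, hσρ⟩)
    · exact ⟨fun h => h.2 subset_rfl, fun t ht => ⟨hK.2 ρ hσK t ht.subset, ht.not_subset⟩⟩
    · exact ⟨fun h => hρ h.1, fun t ht => ⟨hmin t ht, fun h => hσρ (h.trans ht.subset)⟩⟩
end

section
/- Let K be an abstract simplicial complex on a finite vertex set V, let c ≥ 1 be an integer such that every minimal non-face of K has cardinality at least c, and let σ ∈ K be a nonempty face with |σ| ≥ c. Then every minimal non-face of the star deletion sd_σ K has cardinality at least c. -/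
/-- **Star deletion preserves lower bounds on the size of minimal non-faces.**
If every minimal non-face of `K` has cardinality at least `c` and `σ ∈ K` is a
nonempty face with `|σ| ≥ c`, then every minimal non-face of `sd_σ K` has
cardinality at least `c`. -/
theorem minNonFace_card_starDel {α : Type*} [DecidableEq α]
    (K : Set (Finset α)) (hK : IsSimplicialComplex K)
    (c : ℕ) (hc : 1 ≤ c)
    (hmin : ∀ ρ : Finset α, IsMinNonFace K ρ → c ≤ ρ.card)
    (σ : Finset α) (hσK : σ ∈ K) (hσne : σ.Nonempty) (hσc : c ≤ σ.card) :
    ∀ ρ : Finset α, IsMinNonFace (starDel σ K) ρ → c ≤ ρ.card := by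
  intro ρ hρ
  by_cases h : ρ ∈ K
  · have hσρ : σ ⊆ ρ := by
      by_contra hn
      exact hρ.1 ⟨h, hn⟩
    exact hσc.trans (Finset.card_le_card hσρ)
  · exact hmin ρ ⟨h, fun t ht => (hρ.2 t ht).1⟩
end

section
/- Let K be an abstract simplicial complex on the finite vertex set V = {1,…,m}. For each minimal non-face σ of K, let L_σ = {z ∈ ℂ^m : z_i = 0 for all i ∈ σ} be the corresponding coordinate subspace. Then the complement of the coordinate subspace arrangement equals the polyhedral product Z_K(ℂ, ℂ∖{0}): that is, ℂ^m ∖ ⋃_{σ minimal non-face of K} L_σ = ⋃_{τ ∈ K} {z ∈ ℂ^m : z_i ≠ 0 for all i ∉ τ}, as subsets of ℂ^m. -/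
/-- Every finite set outside `K` contains a minimal non-face of `K`. -/
theorem exists_isMinNonFace_subset {α : Type*} {K : Set (Finset α)} {s : Finset α}
    (hs : s ∉ K) : ∃ σ ⊆ s, IsMinNonFace K σ := by
  obtain ⟨σ, hσs, hσ⟩ := exists_minimal_le_of_wellFoundedLT (· ∉ K) s hs
  exact ⟨σ, hσs, hσ.prop, fun t ht => not_not.mp (hσ.not_prop_of_lt ht)⟩

/-- **Coordinate subspace arrangement complement as a polyhedral product.**
The complement in `ℂ^m` of the union of the coordinate subspaces
`L_σ = {z : z_i = 0 for all i ∈ σ}`, over the minimal non-faces `σ` of `K`,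
equals the polyhedral product `Z_K(ℂ, ℂ∖{0}) = ⋃_{τ ∈ K} {z : z_i ≠ 0 for i ∉ τ}`. -/
theorem coordSubspaceComplement_eq_polyhedralProduct
    (m : ℕ) (K : Set (Finset (Fin m))) (hK : IsSimplicialComplex K) :
    (⋃ σ ∈ {s : Finset (Fin m) | IsMinNonFace K s},
        {z : Fin m → ℂ | ∀ i ∈ σ, z i = 0})ᶜ =
      ⋃ τ ∈ K, {z : Fin m → ℂ | ∀ i ∉ τ, z i ≠ 0} := by
  ext z
  simp only [Set.mem_compl_iff, Set.mem_iUnion, Set.mem_ofPred_eq, exists_prop, not_exists, not_and]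
  constructor
  · intro hz
    refine ⟨Finset.univ.filter (z · = 0), ?_, fun i hi => by simpa using hi⟩
    by_contra hs
    obtain ⟨σ, hσs, hσ⟩ := exists_isMinNonFace_subset hs
    exact hz σ hσ fun i hi => (Finset.mem_filter.mp (hσs hi)).2
  · rintro ⟨τ, hτ, hz⟩ σ hσ hzσ
    exact hσ.1 (hK.2 τ hτ σ fun i hi => by_contra fun hiτ => hz i hiτ (hzσ i hi))
end

section
/- Let K⁰ be the abstract simplicial complex on the 9-element vertex set {a,b,c,d,e,f,g,h,i} whose faces are exactly the subsets σ such that {a,b,c} ⊄ σ, {d,e,f} ⊄ σ, and {g,h,i} ⊄ σ (the join of three copies of the boundary of the 2-simplex). Let K = sd_{{a,b,d,f}} sd_{{b,c,d,f}} sd_{{d,e,g,i}} sd_{{e,f,g,i}} K⁰ be the result of the four indicated star deletions. Then the minimal non-faces of K are exactly the seven sets {a,b,c}, {d,e,f}, {g,h,i}, {a,b,d,f}, {b,c,d,f}, {d,e,g,i}, {e,f,g,i}; in particular, every minimal non-face of K has cardinality at least 3. -/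
/-- If the faces of `K` are the sets containing no member of an antichain `F`, then the minimal
non-faces of `K` are exactly the members of `F`. -/
theorem isMinNonFace_iff_mem_of_isAntichain {α : Type*} {F K : Set (Finset α)}
    (hF : IsAntichain (· ⊆ ·) F) (hK : ∀ τ, τ ∈ K ↔ ∀ I ∈ F, ¬ I ⊆ τ) (σ : Finset α) :
    IsMinNonFace K σ ↔ σ ∈ F := by
  constructor
  · rintro ⟨hσ, hmin⟩
    rw [hK] at hσ
    push Not at hσ
    obtain ⟨I, hI, hIσ⟩ := hσ
    rcases hIσ.eq_or_ssubset with rfl | hlt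
    · exact hI
    · exact absurd subset_rfl ((hK I).1 (hmin I hlt) I hI)
  · intro hσ
    refine ⟨fun h => (hK σ).1 h σ hσ subset_rfl, fun t ht => (hK t).2 fun I hI hIt => ?_⟩
    have hIσ : I = σ := hF.eq hI hσ (hIt.trans ht.subset)
    exact ht.not_subset (hIσ ▸ hIt)

/-- **Minimal non-faces of the first Grbić–Linton complex.**
Vertices `0,…,8` stand for `a,…,i`.  `K⁰` is the join of three boundaries of
2-simplices (faces: subsets containing none of `{a,b,c}`, `{d,e,f}`, `{g,h,i}`), and
`K` is obtained by the four star deletions at `{a,b,d,f}`, `{b,c,d,f}`, `{d,e,g,i}`,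
`{e,f,g,i}`.  The minimal non-faces of `K` are exactly the seven listed sets; in
particular each has cardinality at least `3`. -/
theorem gl_example_minNonFaces
    (K0 : Set (Finset (Fin 9)))
    (hK0 : K0 = {s | ¬ ({0, 1, 2} : Finset (Fin 9)) ⊆ s ∧
        ¬ ({3, 4, 5} : Finset (Fin 9)) ⊆ s ∧ ¬ ({6, 7, 8} : Finset (Fin 9)) ⊆ s})
    (K : Set (Finset (Fin 9)))
    (hK : K = starDel {0, 1, 3, 5} (starDel {1, 2, 3, 5}
        (starDel {3, 4, 6, 8} (starDel {4, 5, 6, 8} K0)))) :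
    {σ : Finset (Fin 9) | IsMinNonFace K σ} =
      ({ {0, 1, 2}, {3, 4, 5}, {6, 7, 8}, {0, 1, 3, 5}, {1, 2, 3, 5},
        {3, 4, 6, 8}, {4, 5, 6, 8} } : Set (Finset (Fin 9))) ∧
    ∀ σ : Finset (Fin 9), IsMinNonFace K σ → 3 ≤ σ.card := by
  let F : Finset (Finset (Fin 9)) := { {0, 1, 2}, {3, 4, 5}, {6, 7, 8}, {0, 1, 3, 5},
    {1, 2, 3, 5}, {3, 4, 6, 8}, {4, 5, 6, 8} }
  have hanti : IsAntichain (· ⊆ ·) (F : Set (Finset (Fin 9))) := by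
    have h : ∀ s ∈ F, ∀ t ∈ F, s ≠ t → ¬ s ⊆ t := by decide +kernel
    exact fun s hs t ht => h s hs t ht
  have hface : ∀ τ, τ ∈ K ↔ ∀ I ∈ (F : Set (Finset (Fin 9))), ¬ I ⊆ τ := by
    intro τ
    subst hK hK0
    simp only [starDel, Set.mem_ofPred_eq, F, Finset.mem_coe, Finset.forall_mem_insert,
      Finset.mem_singleton, forall_eq]
    tauto
  have hmin := isMinNonFace_iff_mem_of_isAntichain hanti hface
  constructor
  · ext σ
    rw [Set.mem_ofPred_eq, hmin]
    simp [F]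
  · intro σ hσ
    have hcard : ∀ s ∈ F, 3 ≤ s.card := by decide +kernel
    exact hcard σ ((hmin σ).1 hσ)
end

section
/- Let Φ ∈ ℂ[x_a,x_b,x_c,x_d,x_e,x_f,x_g,x_h,x_i,y_1,…,y_7] be the polynomial Φ = y_1·x_a·x_b·x_c + y_2·x_d·x_e·x_f + y_3·x_g·x_h·x_i + y_4·x_a·x_b·x_d·x_f + y_5·x_b·x_c·x_d·x_f + y_6·x_d·x_e·x_g·x_i + y_7·x_e·x_f·x_g·x_i, and let J ⊆ ℂ[x_a,…,x_i,y_1,…,y_7] be the ideal generated by Φ together with its 16 partial derivatives ∂Φ/∂x_a,…,∂Φ/∂x_i, ∂Φ/∂y_1,…,∂Φ/∂y_7. Then the Krull dimension of the quotient ring ℂ[x_a,…,x_i,y_1,…,y_7]/J equals 10. (Equivalently, the singular locus of the hypersurface V(Φ) ⊆ ℂ^16 has dimension 10 = m + r − 2ν with m = 9, r = 7, ν = 3.) -/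
open MvPolynomial

/-- A finitely generated domain over a field has Krull dimension at most the cardinality of any
set over which it is algebraic. -/
theorem ringKrullDim_le_card_of_isAlgebraic_adjoin {k A : Type} [Field k] [CommRing A] [IsDomain A]
    [Algebra k A] [Algebra.FiniteType k A] (s : Finset A)
    (h : Algebra.IsAlgebraic (Algebra.adjoin k (s : Set A)) A) :
    ringKrullDim A ≤ s.card := by
  obtain ⟨n, g, hinj, hint⟩ := exists_integral_inj_algHom_of_fg k A
  have hdim : ringKrullDim A ≤ ringKrullDim (MvPolynomial (Fin n) k) := by
    algebraize [g.toRingHom]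
    have : Algebra.IsIntegral (MvPolynomial (Fin n) k) A := ⟨hint⟩
    exact Order.krullDim_le_of_strictMono
      (fun p ↦ PrimeSpectrum.comap (algebraMap (MvPolynomial (Fin n) k) A) p)
      fun p q hpq ↦ Ideal.IsIntegral.comap_lt_comap (R := MvPolynomial (Fin n) k) hpq
  have hn : (n : Cardinal.{0}) ≤ s.card := by
    have h₁ := trdeg_le_of_injective g hinj
    rw [MvPolynomial.trdeg_of_isDomain] at h₁
    simpa using h₁.trans (Algebra.IsAlgebraic.trdeg_le_cardinalMk k (s : Set A))
  rw [MvPolynomial.ringKrullDim_of_isNoetherianRing, ringKrullDim_eq_zero_of_field] at hdim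
  refine hdim.trans ?_
  simpa using (by exact_mod_cast hn : n ≤ s.card)

/-- The Krull dimension of a ring is bounded by that of its quotients by primes. -/
theorem ringKrullDim_le_of_forall_quotient_prime {R : Type*} [CommRing R] (n : WithBot ℕ∞)
    (h : ∀ P : Ideal R, P.IsPrime → ringKrullDim (R ⧸ P) ≤ n) : ringKrullDim R ≤ n := by
  rw [ringKrullDim, Order.krullDim_eq_iSup_coheight]
  refine iSup_le fun p ↦ ?_
  rw [Order.coheight_eq_krullDim_Ici]
  exact (ringKrullDim_quotient p.asIdeal).symm.trans_le (h _ p.2)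

/-- If `abc = 0` and `bcy`, `acy`, `aby` are known, then two of the four elements `a, b, c, y`
generate all of them up to division. -/
theorem exists_two_of_mul_eq_zero {k A : Type*} [Field k] [CommRing A] [IsDomain A] [Algebra k A]
    [DecidableEq A] {a b c y u v w : A} (h : a * b * c = 0)
    (ha : b * c * y = u) (hb : a * c * y = v) (hc : a * b * y = w) :
    ∃ s : Finset A, s.card ≤ 2 ∧ ∀ C : Subalgebra k A, (s : Set A) ⊆ C →
      (a ∈ C ∧ b ∈ C ∧ c ∈ C) ∧
      ((∀ p q : A, p ∈ C → p ≠ 0 → p * q ∈ C → q ∈ C) → u ∈ C → v ∈ C → w ∈ C → y ∈ C) := by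
  by_cases h₁ : a = 0 <;> by_cases h₂ : b = 0 <;> by_cases h₃ : c = 0
  · refine ⟨{y}, by simp, fun C hs ↦ ?_⟩
    exact ⟨⟨h₁ ▸ C.zero_mem, h₂ ▸ C.zero_mem, h₃ ▸ C.zero_mem⟩, fun _ _ _ _ ↦ hs (by simp)⟩
  · refine ⟨{c, y}, Finset.card_le_two, fun C hs ↦ ?_⟩
    exact ⟨⟨h₁ ▸ C.zero_mem, h₂ ▸ C.zero_mem, hs (by simp)⟩, fun _ _ _ _ ↦ hs (by simp)⟩
  · refine ⟨{b, y}, Finset.card_le_two, fun C hs ↦ ?_⟩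
    exact ⟨⟨h₁ ▸ C.zero_mem, hs (by simp), h₃ ▸ C.zero_mem⟩, fun _ _ _ _ ↦ hs (by simp)⟩
  · refine ⟨{b, c}, Finset.card_le_two, fun C hs ↦ ?_⟩
    simp only [Finset.coe_insert, Finset.coe_singleton, Set.insert_subset_iff,
      Set.singleton_subset_iff, SetLike.mem_coe] at hs
    exact ⟨⟨h₁ ▸ C.zero_mem, hs⟩, fun hC hu _ _ ↦
      hC (b * c) y (C.mul_mem hs.1 hs.2) (mul_ne_zero h₂ h₃) (ha ▸ hu)⟩
  · refine ⟨{a, y}, Finset.card_le_two, fun C hs ↦ ?_⟩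
    exact ⟨⟨hs (by simp), h₂ ▸ C.zero_mem, h₃ ▸ C.zero_mem⟩, fun _ _ _ _ ↦ hs (by simp)⟩
  · refine ⟨{a, c}, Finset.card_le_two, fun C hs ↦ ?_⟩
    simp only [Finset.coe_insert, Finset.coe_singleton, Set.insert_subset_iff,
      Set.singleton_subset_iff, SetLike.mem_coe] at hs
    exact ⟨⟨hs.1, h₂ ▸ C.zero_mem, hs.2⟩, fun hC _ hv _ ↦
      hC (a * c) y (C.mul_mem hs.1 hs.2) (mul_ne_zero h₁ h₃) (hb ▸ hv)⟩
  · refine ⟨{a, b}, Finset.card_le_two, fun C hs ↦ ?_⟩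
    simp only [Finset.coe_insert, Finset.coe_singleton, Set.insert_subset_iff,
      Set.singleton_subset_iff, SetLike.mem_coe] at hs
    exact ⟨⟨hs.1, hs.2, h₃ ▸ C.zero_mem⟩, fun hC _ _ hw ↦
      hC (a * b) y (C.mul_mem hs.1 hs.2) (mul_ne_zero h₁ h₂) (hc ▸ hw)⟩
  · simp_all

/-- A domain generated by sixteen elements satisfying the equations of the singular locus has Krull
dimension at most `10`. -/
theorem ringKrullDim_le_ten_of_partials_eq_zero {k A : Type} [Field k] [CommRing A] [IsDomain A]
    [Algebra k A] (x : Fin 16 → A) (hx : Algebra.adjoin k (Set.range x) = ⊤)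
    (habc : x 0 * x 1 * x 2 = 0) (hdef : x 3 * x 4 * x 5 = 0) (hghi : x 6 * x 7 * x 8 = 0)
    (h0 : x 9 * x 1 * x 2 + x 12 * x 1 * x 3 * x 5 = 0)
    (h1 : x 9 * x 0 * x 2 + x 12 * x 0 * x 3 * x 5 + x 13 * x 2 * x 3 * x 5 = 0)
    (h2 : x 9 * x 0 * x 1 + x 13 * x 1 * x 3 * x 5 = 0)
    (h3 : x 10 * x 4 * x 5 + x 12 * x 0 * x 1 * x 5 + x 13 * x 1 * x 2 * x 5
      + x 14 * x 4 * x 6 * x 8 = 0)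
    (h4 : x 10 * x 3 * x 5 + x 14 * x 3 * x 6 * x 8 + x 15 * x 5 * x 6 * x 8 = 0)
    (h5 : x 10 * x 3 * x 4 + x 12 * x 0 * x 1 * x 3 + x 13 * x 1 * x 2 * x 3
      + x 15 * x 4 * x 6 * x 8 = 0)
    (h6 : x 11 * x 7 * x 8 + x 14 * x 3 * x 4 * x 8 + x 15 * x 4 * x 5 * x 8 = 0)
    (h7 : x 11 * x 6 * x 8 = 0)
    (h8 : x 11 * x 6 * x 7 + x 14 * x 3 * x 4 * x 6 + x 15 * x 4 * x 5 * x 6 = 0) :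
    ringKrullDim A ≤ 10 := by
  classical
  have : Algebra.FiniteType k A :=
    ⟨⟨(Set.finite_range x).toFinset, by rw [Set.Finite.coe_toFinset, hx]⟩⟩
  obtain ⟨s₁, hs₁, H₁⟩ := exists_two_of_mul_eq_zero (k := k) (y := x 9)
    (u := -(x 12 * x 1 * x 3 * x 5)) (v := -(x 12 * x 0 * x 3 * x 5 + x 13 * x 2 * x 3 * x 5))
    (w := -(x 13 * x 1 * x 3 * x 5)) habc
    (by linear_combination h0) (by linear_combination h1) (by linear_combination h2)
  obtain ⟨s₂, hs₂, H₂⟩ := exists_two_of_mul_eq_zero (k := k) (y := x 10)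
    (u := -(x 12 * x 0 * x 1 * x 5 + x 13 * x 1 * x 2 * x 5 + x 14 * x 4 * x 6 * x 8))
    (v := -(x 14 * x 3 * x 6 * x 8 + x 15 * x 5 * x 6 * x 8))
    (w := -(x 12 * x 0 * x 1 * x 3 + x 13 * x 1 * x 2 * x 3 + x 15 * x 4 * x 6 * x 8)) hdef
    (by linear_combination h3) (by linear_combination h4) (by linear_combination h5)
  obtain ⟨s₃, hs₃, H₃⟩ := exists_two_of_mul_eq_zero (k := k) (y := x 11)
    (u := -(x 14 * x 3 * x 4 * x 8 + x 15 * x 4 * x 5 * x 8)) (v := 0)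
    (w := -(x 14 * x 3 * x 4 * x 6 + x 15 * x 4 * x 5 * x 6)) hghi
    (by linear_combination h6) (by linear_combination h7) (by linear_combination h8)
  let s : Finset A := s₁ ∪ s₂ ∪ s₃ ∪ {x 12, x 13, x 14, x 15}
  have hcard : s.card ≤ 10 := by
    have c₁ := Finset.card_union_le (s₁ ∪ s₂ ∪ s₃) {x 12, x 13, x 14, x 15}
    have c₂ := Finset.card_union_le (s₁ ∪ s₂) s₃
    have c₃ := Finset.card_union_le s₁ s₂
    have c₄ : Finset.card {x 12, x 13, x 14, x 15} ≤ 4 := Finset.card_le_four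
    change (s₁ ∪ s₂ ∪ s₃ ∪ {x 12, x 13, x 14, x 15}).card ≤ 10
    omega
  let B := Algebra.adjoin k (s : Set A)
  let C : Subalgebra k A := (Subalgebra.algebraicClosure B A).restrictScalars k
  have hsC : (s : Set A) ⊆ C := fun a ha ↦
    (isAlgebraic_algebraMap (⟨a, Algebra.subset_adjoin ha⟩ : B) : IsAlgebraic B a)
  have hdiv (p q : A) (hp : p ∈ C) (h₀ : p ≠ 0) (hpq : p * q ∈ C) : q ∈ C :=
    IsAlgebraic.of_mul (R := B) (mem_nonZeroDivisors_of_ne_zero h₀) hp hpq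
  have m12 : x 12 ∈ C := hsC (by simp [s])
  have m13 : x 13 ∈ C := hsC (by simp [s])
  have m14 : x 14 ∈ C := hsC (by simp [s])
  have m15 : x 15 ∈ C := hsC (by simp [s])
  obtain ⟨⟨m0, m1, m2⟩, K₁⟩ := H₁ C fun a ha ↦ hsC (by simp [s, show a ∈ s₁ from ha])
  obtain ⟨⟨m3, m4, m5⟩, K₂⟩ := H₂ C fun a ha ↦ hsC (by simp [s, show a ∈ s₂ from ha])
  obtain ⟨⟨m6, m7, m8⟩, K₃⟩ := H₃ C fun a ha ↦ hsC (by simp [s, show a ∈ s₃ from ha])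
  have m9 : x 9 ∈ C := by
    apply K₁ hdiv <;>
      repeat' first | assumption | apply neg_mem | apply add_mem | apply mul_mem
  have m10 : x 10 ∈ C := by
    apply K₂ hdiv <;>
      repeat' first | assumption | apply neg_mem | apply add_mem | apply mul_mem
  have m11 : x 11 ∈ C := by
    apply K₃ hdiv <;>
      repeat' first | assumption | apply neg_mem | apply zero_mem | apply add_mem | apply mul_mem
  have hC : (⊤ : Subalgebra k A) ≤ C := by
    rw [← hx, Algebra.adjoin_le_iff]
    rintro _ ⟨i, rfl⟩
    fin_cases i <;> assumption
  have halg : Algebra.IsAlgebraic B A := ⟨fun a ↦ hC (Algebra.mem_top (x := a))⟩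
  exact (ringKrullDim_le_card_of_isAlgebraic_adjoin s halg).trans (by exact_mod_cast hcard)

/-- **Dimension of the singular locus of the first Grbić–Linton hypersurface.**
For the polynomial `Φ` in 16 variables (variables `0,…,8` are `x_a,…,x_i`, variables
`9,…,15` are `y_1,…,y_7`), the quotient of the polynomial ring by the ideal generated
by `Φ` and its 16 partial derivatives has Krull dimension `10`; equivalently, the
singular locus of `V(Φ) ⊆ ℂ^16` has dimension `10 = m + r − 2ν` with `m = 9`,
`r = 7`, `ν = 3`. -/
theorem gl_example_singular_locus_dim
    (Φ : MvPolynomial (Fin 16) ℂ)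
    (hΦ : Φ = X 9 * X 0 * X 1 * X 2 + X 10 * X 3 * X 4 * X 5 + X 11 * X 6 * X 7 * X 8
        + X 12 * (X 0 * X 1 * X 3 * X 5) + X 13 * (X 1 * X 2 * X 3 * X 5)
        + X 14 * (X 3 * X 4 * X 6 * X 8) + X 15 * (X 4 * X 5 * X 6 * X 8))
    (J : Ideal (MvPolynomial (Fin 16) ℂ))
    (hJ : J = Ideal.span ({Φ} ∪ Set.range fun v : Fin 16 => pderiv v Φ)) :
    ringKrullDim (MvPolynomial (Fin 16) ℂ ⧸ J) = 10 := by
  apply le_antisymm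
  · refine ringKrullDim_le_of_forall_quotient_prime _ fun P hP ↦ ?_
    let π : MvPolynomial (Fin 16) ℂ →ₐ[ℂ] (MvPolynomial (Fin 16) ℂ ⧸ J) ⧸ P :=
      (Ideal.Quotient.mkₐ ℂ P).comp (Ideal.Quotient.mkₐ ℂ J)
    have hπ : Function.Surjective π :=
      (Ideal.Quotient.mkₐ_surjective ℂ P).comp (Ideal.Quotient.mkₐ_surjective ℂ J)
    have hd (v : Fin 16) : π (pderiv v Φ) = 0 := by
      have : pderiv v Φ ∈ J := hJ ▸ Ideal.subset_span (Or.inr ⟨v, rfl⟩)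
      simp [π, Ideal.Quotient.eq_zero_iff_mem.mpr this]
    refine ringKrullDim_le_ten_of_partials_eq_zero (k := ℂ) (fun i ↦ π (X i)) ?_
      (.trans ?_ (hd 9)) (.trans ?_ (hd 10)) (.trans ?_ (hd 11)) (.trans ?_ (hd 0))
      (.trans ?_ (hd 1)) (.trans ?_ (hd 2)) (.trans ?_ (hd 3)) (.trans ?_ (hd 4))
      (.trans ?_ (hd 5)) (.trans ?_ (hd 6)) (.trans ?_ (hd 7)) (.trans ?_ (hd 8))
    · rw [Set.range_comp' π X, ← AlgHom.map_adjoin, adjoin_range_X, Algebra.map_top,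
        AlgHom.range_eq_top]
      exact hπ
    all_goals
      simp only [← map_mul, ← map_add]
      congr 1
      simp [hΦ, pderiv_X]
      ring
  · let f : Fin 16 → MvPolynomial (Fin 10) ℂ :=
      ![0, 0, X 0, 0, 0, X 1, 0, 0, X 2, X 3, X 4, X 5, X 6, X 7, X 8, X 9]
    let g : Fin 10 → MvPolynomial (Fin 16) ℂ :=
      ![X 2, X 5, X 8, X 9, X 10, X 11, X 12, X 13, X 14, X 15]
    have hfg : (aeval f).comp (aeval g) = AlgHom.id ℂ (MvPolynomial (Fin 10) ℂ) := by
      ext i : 1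
      fin_cases i <;> simp [f, g]
    have hJf : ∀ p ∈ J, aeval f p = 0 := by
      suffices J ≤ RingHom.ker (aeval f : MvPolynomial (Fin 16) ℂ →ₐ[ℂ] _) from this
      rw [hJ, Ideal.span_le]
      rintro _ (rfl | ⟨v, rfl⟩)
      · simp [hΦ, f, RingHom.mem_ker]
      · fin_cases v <;> simp [hΦ, f, RingHom.mem_ker, pderiv_X]
    have hsurj : Function.Surjective (Ideal.Quotient.liftₐ J (aeval f) hJf) := fun q ↦
      ⟨Ideal.Quotient.mk J (aeval g q), by
        exact DFunLike.congr_fun hfg q⟩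
    have := ringKrullDim_le_of_surjective (Ideal.Quotient.liftₐ J (aeval f) hJf).toRingHom hsurj
    rw [MvPolynomial.ringKrullDim_of_isNoetherianRing, ringKrullDim_eq_zero_of_field] at this
    simpa using this
end
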